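/- Let h1 be an empirical model on a measurement scenario (X, M, O) with MIM(h1) = 1, and let e2 be a non-signalling empirical model on the same scenario. Then for every β ∈ [0,1], the empirical model β·h1 + (1−β)·e2 satisfies SF(β·h1 + (1−β)·e2) = β. -/

import Mathlib

/-- Joint outcome assignments for the measurements in `U`. -/
abbrev Assign {X : Type} (O : X → Type) (U : Finset X) : Type :=
  (x : {x : X // x ∈ U}) → O x.1

/-- Marginalisation of a (sub)distribution on `O_U` to `O_V` for `V ⊆ U`. -/
noncomputable def marginal {X : Type} [DecidableEq X] {O : X → Type}
    [∀ x, Fintype (O x)] [∀ x, DecidableEq (O x)]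
    {U V : Finset X} (h : V ⊆ U) (d : Assign O U → ℝ) : Assign O V → ℝ :=
  fun t => ∑ s : Assign O U,
    if (fun x : {x : X // x ∈ V} => s ⟨x.1, h x.2⟩) = t then d s else 0

/-- A model on the scenario with contexts `M`: a real-valued table for each context. -/
abbrev Model {X : Type} (O : X → Type) (M : Finset (Finset X)) : Type :=
  (C : {C : Finset X // C ∈ M}) → Assign O C.1 → ℝ

/-- `M` is a covering family of contexts for `X`. -/
def Covers {X : Type} (M : Finset (Finset X)) : Prop :=
  ∀ x : X, ∃ C ∈ M, x ∈ C

/-- An empirical model: each context carries a probability distribution. -/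
def IsEmpirical {X : Type} [DecidableEq X] {O : X → Type} [∀ x, Fintype (O x)]
    {M : Finset (Finset X)} (e : Model O M) : Prop :=
  ∀ C, (∀ s, 0 ≤ e C s) ∧ (∑ s, e C s) = 1

/-- Non-signalling: marginals agree on intersections of contexts. -/
def NonSignalling {X : Type} [DecidableEq X] {O : X → Type}
    [∀ x, Fintype (O x)] [∀ x, DecidableEq (O x)]
    {M : Finset (Finset X)} (e : Model O M) : Prop :=
  ∀ C C' : {C : Finset X // C ∈ M},
    marginal (Finset.inter_subset_left : C.1 ∩ C'.1 ⊆ C.1) (e C) =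
      marginal (Finset.inter_subset_right : C.1 ∩ C'.1 ⊆ C'.1) (e C')

/-- Deterministic: each context carries a Dirac (point-mass) distribution. -/
def Deterministic {X : Type} [DecidableEq X] {O : X → Type} [∀ x, DecidableEq (O x)]
    {M : Finset (Finset X)} (e : Model O M) : Prop :=
  ∀ C, ∃ s₀ : Assign O C.1, ∀ s, e C s = if s = s₀ then 1 else 0

/-- Marginal of a function on global assignments to the context `C`. -/
noncomputable def globMarg {X : Type} [Fintype X] [DecidableEq X] (O : X → Type)
    [∀ x, Fintype (O x)] [∀ x, DecidableEq (O x)]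
    (C : Finset X) (b : (∀ x, O x) → ℝ) : Assign O C → ℝ :=
  fun t => ∑ g : ∀ x, O x,
    if (fun x : {x : X // x ∈ C} => g x.1) = t then b g else 0

/-- The noncontextual fraction. -/
noncomputable def NCF {X : Type} [Fintype X] [DecidableEq X] {O : X → Type}
    [∀ x, Fintype (O x)] [∀ x, DecidableEq (O x)]
    {M : Finset (Finset X)} (e : Model O M) : ℝ :=
  sSup { r | ∃ b : (∀ x, O x) → ℝ, (∀ g, 0 ≤ b g) ∧
    (∀ C : {C : Finset X // C ∈ M}, ∀ t, globMarg O C.1 b t ≤ e C t) ∧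
    r = ∑ g, b g }

/-- The contextual fraction. -/
noncomputable def CF {X : Type} [Fintype X] [DecidableEq X] {O : X → Type}
    [∀ x, Fintype (O x)] [∀ x, DecidableEq (O x)]
    {M : Finset (Finset X)} (e : Model O M) : ℝ :=
  1 - NCF e

/-- The non-signalling fraction. -/
noncomputable def NSF {X : Type} [Fintype X] [DecidableEq X] {O : X → Type}
    [∀ x, Fintype (O x)] [∀ x, DecidableEq (O x)]
    {M : Finset (Finset X)} (e : Model O M) : ℝ :=
  sSup { r | ∃ b : (∀ x, O x) → ℝ,
    (∀ C : {C : Finset X // C ∈ M}, ∀ t,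
      0 ≤ globMarg O C.1 b t ∧ globMarg O C.1 b t ≤ e C t) ∧
    r = ∑ g, b g }

/-- The signalling fraction. -/
noncomputable def SF {X : Type} [Fintype X] [DecidableEq X] {O : X → Type}
    [∀ x, Fintype (O x)] [∀ x, DecidableEq (O x)]
    {M : Finset (Finset X)} (e : Model O M) : ℝ :=
  1 - NSF e

/-- The maximum incompatibility of marginals. -/
noncomputable def MIM {X : Type} [DecidableEq X] {O : X → Type}
    [∀ x, Fintype (O x)] [∀ x, DecidableEq (O x)]
    {M : Finset (Finset X)} (e : Model O M) : ℝ :=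
  sSup { r | ∃ C C' : {C : Finset X // C ∈ M}, C.1 ≠ C'.1 ∧
    ∃ t : Assign O (C.1 ∩ C'.1),
      r = |marginal (Finset.inter_subset_left : C.1 ∩ C'.1 ⊆ C.1) (e C) t -
            marginal (Finset.inter_subset_right : C.1 ∩ C'.1 ⊆ C'.1) (e C') t| }

/-- The generalised total variation distance between two models. -/
noncomputable def tvDist {X : Type} [DecidableEq X] {O : X → Type}
    [∀ x, Fintype (O x)]
    {M : Finset (Finset X)} (e e' : Model O M) : ℝ :=
  sSup { r | ∃ C : {C : Finset X // C ∈ M}, r = (1/2) * ∑ s, |e C s - e' C s| }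

/-- The global assignment that agrees with `s` on `C` and with `o` elsewhere. -/
def extendAssign {X : Type} [DecidableEq X] {O : X → Type} (o : ∀ x, O x) {C : Finset X}
    (s : Assign O C) : ∀ x, O x :=
  fun x => if h : x ∈ C then s ⟨x, h⟩ else o x

section SignallingFraction

variable {X : Type} [DecidableEq X] {O : X → Type}
  [∀ x, Fintype (O x)] [∀ x, DecidableEq (O x)]

lemma marginal_add {U V : Finset X} (h : V ⊆ U) (d d' : Assign O U → ℝ) :
    marginal h (d + d') = marginal h d + marginal h d' := by
  funext t
  simp only [marginal, Pi.add_apply, ← Finset.sum_add_distrib]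
  exact Finset.sum_congr rfl fun s _ => by split_ifs <;> simp

lemma marginal_smul {U V : Finset X} (h : V ⊆ U) (a : ℝ) (d : Assign O U → ℝ) :
    marginal h (a • d) = a • marginal h d := by
  funext t
  simp [marginal, Finset.mul_sum]

lemma marginal_mono {U V : Finset X} (h : V ⊆ U) {d d' : Assign O U → ℝ}
    (hd : ∀ s, d s ≤ d' s) (t : Assign O V) : marginal h d t ≤ marginal h d' t :=
  Finset.sum_le_sum fun s _ => by split_ifs <;> simp [hd]

lemma sum_marginal {U V : Finset X} (h : V ⊆ U) (d : Assign O U → ℝ) :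
    ∑ t, marginal h d t = ∑ s, d s := by
  simp only [marginal]
  rw [Finset.sum_comm]
  simp

/-- The supremum defining `MIM` is attained when it is nonzero. -/
lemma exists_abs_marginal_sub_eq_MIM {M : Finset (Finset X)} {e : Model O M} (he : MIM e ≠ 0) :
    ∃ C C' : {C : Finset X // C ∈ M}, ∃ t : Assign O (C.1 ∩ C'.1),
      |marginal (Finset.inter_subset_left : C.1 ∩ C'.1 ⊆ C.1) (e C) t -
        marginal (Finset.inter_subset_right : C.1 ∩ C'.1 ⊆ C'.1) (e C') t| = MIM e := by
  let f : (Σ p : {C : Finset X // C ∈ M} × {C : Finset X // C ∈ M}, Assign O (p.1.1 ∩ p.2.1)) → ℝ :=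
    fun q => |marginal (Finset.inter_subset_left : q.1.1.1 ∩ q.1.2.1 ⊆ q.1.1.1) (e q.1.1) q.2 -
        marginal (Finset.inter_subset_right : q.1.1.1 ∩ q.1.2.1 ⊆ q.1.2.1) (e q.1.2) q.2|
  unfold MIM at he ⊢
  generalize hS : { r | ∃ C C' : {C : Finset X // C ∈ M}, C.1 ≠ C'.1 ∧
    ∃ t : Assign O (C.1 ∩ C'.1),
      r = |marginal (Finset.inter_subset_left : C.1 ∩ C'.1 ⊆ C.1) (e C) t -
            marginal (Finset.inter_subset_right : C.1 ∩ C'.1 ⊆ C'.1) (e C') t| } = S at he ⊢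
  have hne : S.Nonempty := Set.nonempty_iff_ne_empty.2 fun h => he (by rw [h, Real.sSup_empty])
  have hfin : S.Finite := (Set.finite_range f).subset <| by
    rw [← hS]
    rintro r ⟨C, C', -, t, rfl⟩
    exact ⟨⟨(C, C'), t⟩, rfl⟩
  obtain ⟨C, C', -, t, ht⟩ := hS.ge (hne.csSup_mem hfin)
  exact ⟨C, C', t, ht.symm⟩

variable [Fintype X]

lemma globMarg_add (C : Finset X) (b b' : (∀ x, O x) → ℝ) :
    globMarg O C (b + b') = globMarg O C b + globMarg O C b' := by
  funext t
  simp only [globMarg, Pi.add_apply, ← Finset.sum_add_distrib]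
  exact Finset.sum_congr rfl fun s _ => by split_ifs <;> simp

lemma globMarg_smul (C : Finset X) (a : ℝ) (b : (∀ x, O x) → ℝ) :
    globMarg O C (a • b) = a • globMarg O C b := by
  funext t
  simp [globMarg, Finset.mul_sum]

lemma sum_globMarg (C : Finset X) (b : (∀ x, O x) → ℝ) :
    ∑ t, globMarg O C b t = ∑ g, b g := by
  simp only [globMarg]
  rw [Finset.sum_comm]
  simp

lemma marginal_globMarg {U V : Finset X} (h : V ⊆ U) (b : (∀ x, O x) → ℝ) :
    marginal h (globMarg O U b) = globMarg O V b := by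
  funext t
  have key : ∀ s : Assign O U,
      (if (fun x : {x : X // x ∈ V} => s ⟨x.1, h x.2⟩) = t then
        ∑ g : ∀ x, O x, (if (fun x : {x : X // x ∈ U} => g x.1) = s then b g else 0) else 0) =
      ∑ g : ∀ x, O x, (if (fun x : {x : X // x ∈ U} => g x.1) = s then
        (if (fun x : {x : X // x ∈ V} => g x.1) = t then b g else 0) else 0) := by
    intro s
    rw [Finset.ite_sum_zero]
    refine Finset.sum_congr rfl fun g _ => ?_
    by_cases hg : (fun x : {x : X // x ∈ U} => g x.1) = s
    · subst hg
      simp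
    · simp [hg]
  simp only [marginal, globMarg]
  rw [Finset.sum_congr rfl fun s _ => key s, Finset.sum_comm]
  simp

/-- The pushforward of a table on `O_C` along `extendAssign o`. -/
noncomputable def extendTable (o : ∀ x, O x) {C : Finset X} (d : Assign O C → ℝ) :
    (∀ x, O x) → ℝ :=
  fun g => ∑ s : Assign O C, if extendAssign o s = g then d s else 0

lemma globMarg_extendTable (o : ∀ x, O x) {C : Finset X} (C' : Finset X) (d : Assign O C → ℝ)
    (t : Assign O C') :
    globMarg O C' (extendTable o d) t =
      ∑ s : Assign O C,
        if (fun x : {x : X // x ∈ C'} => extendAssign o s x.1) = t then d s else 0 := by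
  have key : ∀ g : ∀ x, O x,
      (if (fun x : {x : X // x ∈ C'} => g x.1) = t then extendTable o d g else 0) =
      ∑ s : Assign O C, (if extendAssign o s = g then
        (if (fun x : {x : X // x ∈ C'} => extendAssign o s x.1) = t then d s else 0) else 0) := by
    intro g
    rw [extendTable, Finset.ite_sum_zero]
    refine Finset.sum_congr rfl fun s _ => ?_
    by_cases hg : extendAssign o s = g
    · subst hg
      simp
    · simp [hg]
  simp only [globMarg]
  rw [Finset.sum_congr rfl fun s _ => key s, Finset.sum_comm]
  simp

lemma globMarg_extendTable_self (o : ∀ x, O x) {C : Finset X} (d : Assign O C → ℝ) :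
    globMarg O C (extendTable o d) = d := by
  funext t
  have key : ∀ s : Assign O C, (fun x : {x : X // x ∈ C} => extendAssign o s x.1) = s := by
    intro s
    funext x
    simp [extendAssign]
  rw [globMarg_extendTable]
  simp [key]

/-- A table whose marginal on `C ∩ C'` vanishes extends to one whose marginal on `C'` vanishes. -/
lemma globMarg_extendTable_eq_zero (o : ∀ x, O x) {C C' : Finset X} (d : Assign O C → ℝ)
    (hd : marginal (Finset.inter_subset_left : C ∩ C' ⊆ C) d = 0) :
    globMarg O C' (extendTable o d) = 0 := by
  funext t
  rw [globMarg_extendTable]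
  by_cases ht : ∀ x : {x : X // x ∈ C'}, x.1 ∉ C → t x = o x.1
  · have h0 := congrFun hd fun x => t ⟨x.1, Finset.inter_subset_right x.2⟩
    rw [marginal] at h0
    refine Eq.trans ?_ h0
    refine Finset.sum_congr rfl fun s _ => if_congr ?_ rfl rfl
    simp only [funext_iff, extendAssign]
    constructor
    · intro hs x
      have hx := hs ⟨x.1, Finset.inter_subset_right x.2⟩
      rwa [dif_pos (Finset.inter_subset_left x.2)] at hx
    · intro hs x
      split_ifs with hx
      · exact hs ⟨x.1, Finset.mem_inter.2 ⟨hx, x.2⟩⟩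
      · exact (ht x hx).symm
  · push Not at ht
    obtain ⟨x, hx, hne⟩ := ht
    refine Finset.sum_eq_zero fun s _ => if_neg fun hs => hne ?_
    rw [← congrFun hs x, extendAssign, dif_neg hx]

/-- A non-signalling model has a signed global section. -/
theorem NonSignalling.exists_globMarg_eq [∀ x, Nonempty (O x)] {M : Finset (Finset X)}
    {e : Model O M} (he : NonSignalling e) :
    ∃ b : (∀ x, O x) → ℝ, ∀ C, globMarg O C.1 b = e C := by
  obtain ⟨o⟩ : Nonempty (∀ x, O x) := inferInstance
  suffices H : ∀ S : Finset {C : Finset X // C ∈ M},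
      ∃ b : (∀ x, O x) → ℝ, ∀ C ∈ S, globMarg O C.1 b = e C by
    obtain ⟨b, hb⟩ := H Finset.univ
    exact ⟨b, fun C => hb C (Finset.mem_univ C)⟩
  intro S
  induction S using Finset.induction_on with
  | empty => exact ⟨0, by simp⟩
  | insert C S _ ih =>
    obtain ⟨b, hb⟩ := ih
    refine ⟨b + extendTable o (e C + (-1 : ℝ) • globMarg O C.1 b), fun C' hC' => ?_⟩
    rw [globMarg_add]
    rcases Finset.mem_insert.1 hC' with rfl | hC'
    · rw [globMarg_extendTable_self]
      simp
    · rw [globMarg_extendTable_eq_zero, hb C' hC', add_zero]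
      rw [marginal_add, marginal_smul, marginal_globMarg, he C C', ← hb C' hC', marginal_globMarg]
      simp

/-- The mass of a global table below two distributions is bounded by the agreement of their
marginals at any joint outcome. -/
lemma sum_le_one_sub_marginal_sub {U U' V : Finset X} (hU : V ⊆ U) (hU' : V ⊆ U')
    {d : Assign O U → ℝ} {d' : Assign O U' → ℝ} {b : (∀ x, O x) → ℝ}
    (hb : ∀ s, globMarg O U b s ≤ d s) (hb' : ∀ s, globMarg O U' b s ≤ d' s)
    (hd : ∑ s, d s = 1) (t : Assign O V) :
    ∑ g, b g ≤ 1 - (marginal hU d t - marginal hU' d' t) := by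
  have h1 := marginal_mono hU hb
  have h2 := marginal_mono hU' hb' t
  rw [marginal_globMarg] at h1 h2
  have h3 : ∑ u ∈ Finset.univ.erase t, globMarg O V b u ≤
      ∑ u ∈ Finset.univ.erase t, marginal hU d u := Finset.sum_le_sum fun u _ => h1 u
  have h4 := Finset.add_sum_erase Finset.univ (globMarg O V b) (Finset.mem_univ t)
  have h5 := Finset.add_sum_erase Finset.univ (marginal hU d) (Finset.mem_univ t)
  rw [sum_globMarg] at h4
  rw [sum_marginal, hd] at h5
  linarith

end SignallingFraction

theorem SF_of_mixture_with_maximally_signalling {X : Type} [Fintype X] [DecidableEq X] {O : X → Type}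
    [∀ x, Fintype (O x)] [∀ x, DecidableEq (O x)] [∀ x, Nonempty (O x)]
    {M : Finset (Finset X)} (hM : Covers M)
    (h1 e2 : Model O M) (he1 : IsEmpirical h1) (he2 : IsEmpirical e2)
    (hMIM : MIM h1 = 1) (hNS : NonSignalling e2)
    (β : ℝ) (hβ : β ∈ Set.Icc (0:ℝ) 1) :
    SF (β • h1 + (1-β) • e2) = β := by
  obtain ⟨hβ0, hβ1⟩ := hβ
  obtain ⟨C, C', t, ht⟩ := exists_abs_marginal_sub_eq_MIM (e := h1) (by simp [hMIM])
  rw [hMIM] at ht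
  obtain ⟨b, hb⟩ := hNS.exists_globMarg_eq
  have hsum : ∀ D, ∑ s, (β • h1 + (1 - β) • e2) D s = 1 := by
    intro D
    simp only [Pi.add_apply, Pi.smul_apply, smul_eq_mul, Finset.sum_add_distrib,
      ← Finset.mul_sum, (he1 D).2, (he2 D).2]
    ring
  suffices h : IsGreatest { r | ∃ b : (∀ x, O x) → ℝ,
      (∀ C : {C : Finset X // C ∈ M}, ∀ t,
        0 ≤ globMarg O C.1 b t ∧ globMarg O C.1 b t ≤ (β • h1 + (1 - β) • e2) C t) ∧
      r = ∑ g, b g } (1 - β) by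
    rw [SF, NSF, h.csSup_eq, sub_sub_cancel]
  refine ⟨⟨(1 - β) • b, fun D s => ?_, ?_⟩, ?_⟩
  · have hs1 := mul_nonneg hβ0 ((he1 D).1 s)
    have hs2 := mul_nonneg (sub_nonneg.2 hβ1) ((he2 D).1 s)
    rw [globMarg_smul, hb D]
    simp only [Pi.add_apply, Pi.smul_apply, smul_eq_mul]
    constructor <;> linarith
  · rw [← sum_globMarg C.1, globMarg_smul, hb C]
    simp [← Finset.mul_sum, (he2 C).2]
  · rintro _ ⟨c, hc, rfl⟩
    have hle := sum_le_one_sub_marginal_sub Finset.inter_subset_left Finset.inter_subset_right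
      (fun s => (hc C s).2) (fun s => (hc C' s).2) (hsum C) t
    have hge := sum_le_one_sub_marginal_sub Finset.inter_subset_right Finset.inter_subset_left
      (fun s => (hc C' s).2) (fun s => (hc C s).2) (hsum C') t
    have hns := congrFun (hNS C C') t
    have hmix : ∀ D, (β • h1 + (1 - β) • e2) D = β • h1 D + (1 - β) • e2 D := fun _ => rfl
    simp only [hmix, marginal_add, marginal_smul] at hle hge
    simp only [Pi.add_apply, Pi.smul_apply, smul_eq_mul, hns] at hle hge
    rcases eq_or_eq_neg_of_abs_eq ht with h | h
    · linear_combination hle - β * h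
    · linear_combination hge + β * h
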